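/- Let γ be a smooth family of nondegenerate classical paths over an open set O ⊆ ℝ_{>0} × ℝ^n × ℝ^n with Hamilton function S_γ. Then for all (t,q_0,q_1) ∈ O, all a, b ∈ {0,1} and all indices j, k: ∂²(−S_γ)/∂q_a^j∂q_b^k (t,q_0,q_1) = −h_γ(∂γ/∂q_a^j, ∂γ/∂q_b^k), where ∂γ/∂q_a^j denotes the Jacobi field τ ↦ ∂γ(τ;t,q_0,q_1)/∂q_a^j and h_γ is the Hessian of the action. -/

import Mathlib

open MeasureTheory Set
open scoped BigOperators

noncomputable section

/-- Partial derivative of `f : ℝⁿ → ℝ` in the `j`-th coordinate direction. -/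
def pd {n : ℕ} (f : (Fin n → ℝ) → ℝ) (j : Fin n) (q : Fin n → ℝ) : ℝ :=
  fderiv ℝ f q (Pi.single j 1)

/-- The classical equation of motion on the time interval `[0, t]`. -/
def IsClassical {n : ℕ} (B : Fin n → (Fin n → ℝ) → ℝ) (C : (Fin n → ℝ) → ℝ)
    (t : ℝ) (γ : ℝ → Fin n → ℝ) : Prop :=
  ∀ τ ∈ Icc (0:ℝ) t, ∀ i,
    deriv (deriv γ) τ i
      + (∑ j, (pd (B i) j (γ τ) - pd (B j) i (γ τ)) * deriv γ τ j)
      + pd C i (γ τ) = 0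

/-- The Jacobi operator `D_γ` (linearization of the equation of motion along `γ`). -/
def Jacobi {n : ℕ} (B : Fin n → (Fin n → ℝ) → ℝ) (C : (Fin n → ℝ) → ℝ)
    (γ ξ : ℝ → Fin n → ℝ) (τ : ℝ) (i : Fin n) : ℝ :=
  deriv (deriv ξ) τ i
    + (∑ j, (pd (B i) j (γ τ) - pd (B j) i (γ τ)) * deriv ξ τ j)
    + ∑ j, ((∑ k, pd (fun q => pd (B i) k q - pd (B k) i q) j (γ τ) * deriv γ τ k)
        + pd (pd C i) j (γ τ)) * ξ τ j

/-- A classical path of duration `t` is nondegenerate if the only smooth based loop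
annihilated by the Jacobi operator vanishes identically on `[0,t]`. -/
def Nondegenerate {n : ℕ} (B : Fin n → (Fin n → ℝ) → ℝ) (C : (Fin n → ℝ) → ℝ)
    (t : ℝ) (γ : ℝ → Fin n → ℝ) : Prop :=
  ∀ ξ : ℝ → Fin n → ℝ, ContDiff ℝ (⊤ : ℕ∞) ξ → ξ 0 = 0 → ξ t = 0 →
    (∀ τ ∈ Icc (0:ℝ) t, ∀ i, Jacobi B C γ ξ τ i = 0) →
    ∀ τ ∈ Icc (0:ℝ) t, ξ τ = 0

/-- The action of a path of duration `t`. -/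
def action {n : ℕ} (B : Fin n → (Fin n → ℝ) → ℝ) (C : (Fin n → ℝ) → ℝ)
    (t : ℝ) (γ : ℝ → Fin n → ℝ) : ℝ :=
  ∫ τ in (0:ℝ)..t,
    ((1:ℝ)/2 * ∑ i, deriv γ τ i ^ 2 + ∑ i, B i (γ τ) * deriv γ τ i - C (γ τ))

/-- A smooth family of nondegenerate classical paths with boundary values
`(t, q₀, q₁)` ranging over an open set `O ⊆ ℝ_{>0} × ℝⁿ × ℝⁿ`. -/
structure SmoothFamily {n : ℕ} (B : Fin n → (Fin n → ℝ) → ℝ) (C : (Fin n → ℝ) → ℝ)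
    (O : Set (ℝ × (Fin n → ℝ) × (Fin n → ℝ))) where
  f : ℝ → ℝ → (Fin n → ℝ) → (Fin n → ℝ) → Fin n → ℝ
  isOpen : IsOpen O
  pos : ∀ p ∈ O, 0 < p.1
  smooth : ContDiffOn ℝ (⊤ : ℕ∞)
      (fun p : ℝ × ℝ × (Fin n → ℝ) × (Fin n → ℝ) => f p.1 p.2.1 p.2.2.1 p.2.2.2)
      {p : ℝ × ℝ × (Fin n → ℝ) × (Fin n → ℝ) | p.2 ∈ O ∧ p.1 ∈ Icc 0 p.2.1}
  pathSmooth : ∀ p ∈ O, ContDiff ℝ (⊤ : ℕ∞) fun τ => f τ p.1 p.2.1 p.2.2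
  isClassical : ∀ p ∈ O, IsClassical B C p.1 fun τ => f τ p.1 p.2.1 p.2.2
  nondeg : ∀ p ∈ O, Nondegenerate B C p.1 fun τ => f τ p.1 p.2.1 p.2.2
  bdry0 : ∀ p ∈ O, f 0 p.1 p.2.1 p.2.2 = p.2.1
  bdry1 : ∀ p ∈ O, f p.1 p.1 p.2.1 p.2.2 = p.2.2

/-- The Hamilton function of a smooth family of classical paths. -/
def famS {n : ℕ} {B : Fin n → (Fin n → ℝ) → ℝ} {C : (Fin n → ℝ) → ℝ}
    {O : Set (ℝ × (Fin n → ℝ) × (Fin n → ℝ))} (F : SmoothFamily B C O)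
    (t : ℝ) (q0 q1 : Fin n → ℝ) : ℝ :=
  action B C t fun τ => F.f τ t q0 q1

/-- The mixed Hessian `(l, m) ↦ ∂²S/∂q₀^l∂q₁^m`. -/
def Hess01 {n : ℕ} (S : ℝ → (Fin n → ℝ) → (Fin n → ℝ) → ℝ)
    (t : ℝ) (q0 q1 : Fin n → ℝ) : Matrix (Fin n) (Fin n) ℝ :=
  Matrix.of fun l m =>
    fderiv ℝ (fun q0' => fderiv ℝ (fun q1' => S t q0' q1') q1 (Pi.single m 1)) q0
      (Pi.single l 1)

/-- Heaviside's step function, with `Θ 0 = 1/2`. -/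
def Heav (x : ℝ) : ℝ := if x < 0 then 0 else if x = 0 then 1/2 else 1

/-- The Green's kernel `G_γ` of a smooth family of nondegenerate classical paths. -/
def Green {n : ℕ} {B : Fin n → (Fin n → ℝ) → ℝ} {C : (Fin n → ℝ) → ℝ}
    {O : Set (ℝ × (Fin n → ℝ) × (Fin n → ℝ))} (F : SmoothFamily B C O)
    (t : ℝ) (q0 q1 : Fin n → ℝ) (ς τ : ℝ) (i j : Fin n) : ℝ :=
  Heav (ς - τ) * ∑ k, ∑ l,
      fderiv ℝ (fun q => F.f ς t q q1 i) q0 (Pi.single k 1)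
        * ((Hess01 (fun a b c => -(famS F a b c)) t q0 q1).transpose)⁻¹ k l
        * fderiv ℝ (fun q => F.f τ t q0 q j) q1 (Pi.single l 1)
  + Heav (τ - ς) * ∑ k, ∑ l,
      fderiv ℝ (fun q => F.f ς t q0 q i) q1 (Pi.single k 1)
        * (Hess01 (fun a b c => -(famS F a b c)) t q0 q1)⁻¹ k l
        * fderiv ℝ (fun q => F.f τ t q q1 j) q0 (Pi.single l 1)

/-- The Hessian of the action at a path `γ` of duration `t`, as a bilinear form. -/
def hess {n : ℕ} (B : Fin n → (Fin n → ℝ) → ℝ) (C : (Fin n → ℝ) → ℝ)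
    (t : ℝ) (γ ξ ζ : ℝ → Fin n → ℝ) : ℝ :=
  ∫ τ in (0:ℝ)..t,
    ((∑ i, deriv ξ τ i * deriv ζ τ i)
      + (∑ i, ∑ j, pd (B i) j (γ τ) * (deriv ξ τ i * ζ τ j + deriv ζ τ i * ξ τ j))
      + ∑ j, ∑ k,
          ((∑ i, pd (pd (B i) j) k (γ τ) * deriv γ τ i) - pd (pd C j) k (γ τ))
            * (ξ τ j * ζ τ k))

/-- The Jacobi fields `∂γ/∂q_a^j` of a smooth family (`a = 0` or `a = 1`). -/
def jfield {n : ℕ} {B : Fin n → (Fin n → ℝ) → ℝ} {C : (Fin n → ℝ) → ℝ}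
    {O : Set (ℝ × (Fin n → ℝ) × (Fin n → ℝ))} (F : SmoothFamily B C O)
    (t : ℝ) (q0 q1 : Fin n → ℝ) (a : Fin 2) (j : Fin n) : ℝ → Fin n → ℝ :=
  fun τ i =>
    if a = 0 then fderiv ℝ (fun q => F.f τ t q q1 i) q0 (Pi.single j 1)
    else fderiv ℝ (fun q => F.f τ t q0 q i) q1 (Pi.single j 1)

/-- Partial derivative of a function of `(t, q₀, q₁)` in the direction `q_a^j`. -/
def pdS {n : ℕ} (S : ℝ → (Fin n → ℝ) → (Fin n → ℝ) → ℝ) (a : Fin 2) (j : Fin n)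
    (t : ℝ) (q0 q1 : Fin n → ℝ) : ℝ :=
  if a = 0 then fderiv ℝ (fun q => S t q q1) q0 (Pi.single j 1)
  else fderiv ℝ (fun q => S t q0 q) q1 (Pi.single j 1)

/-- Directional derivative within a set. -/
def Ds {V : Type*} [NormedAddCommGroup V] [NormedSpace ℝ V] (s : Set V) (v : V) (φ : V → ℝ) :
    V → ℝ := fun p => fderivWithin ℝ φ s p v

/-- `φ` is differentiable at `p` within `s` with directional derivative `d` along `v`. -/
def HasD {V : Type*} [NormedAddCommGroup V] [NormedSpace ℝ V] (s : Set V) (v p : V) (φ : V → ℝ)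
    (d : ℝ) : Prop := ∃ f' : V →L[ℝ] ℝ, HasFDerivWithinAt φ f' s p ∧ f' v = d

section HasDRules

variable {V : Type*} [NormedAddCommGroup V] [NormedSpace ℝ V] {s : Set V} {v w p : V}
  {φ ψ : V → ℝ} {a b : ℝ}

theorem HasD.of_smooth (hφ : ContDiffOn ℝ (⊤ : ℕ∞) φ s) (hp : p ∈ s) :
    HasD s v p φ (Ds s v φ p) :=
  ⟨_, ((hφ.differentiableOn (by simp)) p hp).hasFDerivWithinAt, rfl⟩

theorem HasD.eq (h : HasD s v p φ a) (hs : UniqueDiffOn ℝ s) (hp : p ∈ s) : Ds s v φ p = a := by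
  obtain ⟨f', h1, h2⟩ := h
  rw [Ds, h1.fderivWithin (hs p hp), h2]

theorem HasD.add (h1 : HasD s v p φ a) (h2 : HasD s v p ψ b) :
    HasD s v p (fun x => φ x + ψ x) (a + b) := by
  obtain ⟨f, hf, rfl⟩ := h1
  obtain ⟨g, hg, rfl⟩ := h2
  exact ⟨f + g, hf.add hg, by simp⟩

theorem HasD.sub (h1 : HasD s v p φ a) (h2 : HasD s v p ψ b) :
    HasD s v p (fun x => φ x - ψ x) (a - b) := by
  obtain ⟨f, hf, rfl⟩ := h1
  obtain ⟨g, hg, rfl⟩ := h2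
  exact ⟨f - g, hf.sub hg, by simp⟩

theorem HasD.mul (h1 : HasD s v p φ a) (h2 : HasD s v p ψ b) :
    HasD s v p (fun x => φ x * ψ x) (a * ψ p + φ p * b) := by
  obtain ⟨f, hf, rfl⟩ := h1
  obtain ⟨g, hg, rfl⟩ := h2
  refine ⟨_, hf.mul hg, ?_⟩
  simp only [add_apply, smul_apply, smul_eq_mul]
  ring

theorem HasD.sum {n : ℕ} {φ : Fin n → V → ℝ} {a : Fin n → ℝ} (h : ∀ i, HasD s v p (φ i) (a i)) :
    HasD s v p (fun x => ∑ i, φ i x) (∑ i, a i) := by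
  choose f hf h2 using h
  refine ⟨∑ i, f i, HasFDerivWithinAt.fun_sum (fun i _ => hf i), ?_⟩
  simp [h2]

theorem HasD.comp {n : ℕ} {g : Fin n → V → ℝ} {d : Fin n → ℝ} {F : (Fin n → ℝ) → ℝ}
    (hF : ContDiff ℝ (⊤ : ℕ∞) F) (h : ∀ i, HasD s v p (g i) (d i)) :
    HasD s v p (fun x => F (fun i => g i x)) (∑ j, pd F j (fun i => g i p) * d j) := by
  choose f hf h2 using h
  have h3 : HasFDerivWithinAt (fun x => fun i => g i x) (ContinuousLinearMap.pi f) s p :=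
    hasFDerivWithinAt_pi.2 hf
  have h4 := ((hF.differentiable (by simp)) (fun i => g i p)).hasFDerivAt.comp_hasFDerivWithinAt p h3
  refine ⟨_, h4, ?_⟩
  have h5 : (ContinuousLinearMap.pi f) v = ∑ j, d j • (Pi.single j (1:ℝ) : Fin n → ℝ) := by
    ext i
    simp [h2, Finset.sum_apply, Pi.single_apply]
  rw [ContinuousLinearMap.comp_apply, h5, map_sum]
  refine Finset.sum_congr rfl fun j _ => ?_
  rw [map_smul, pd, smul_eq_mul, mul_comm]

theorem Ds_contDiffOn (hs : UniqueDiffOn ℝ s) (hφ : ContDiffOn ℝ (⊤ : ℕ∞) φ s) (v : V) :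
    ContDiffOn ℝ (⊤ : ℕ∞) (Ds s v φ) s :=
  (hφ.fderivWithin hs (m := ((⊤ : ℕ∞) : WithTop ℕ∞)) (by simp)).clm_apply contDiffOn_const

theorem Ds_congr (h : EqOn φ ψ s) (hp : p ∈ s) : Ds s v φ p = Ds s v ψ p := by
  rw [Ds, Ds, fderivWithin_congr h (h hp)]

theorem Ds_comm (hs : UniqueDiffOn ℝ s) (hc : s ⊆ closure (interior s))
    (hφ : ContDiffOn ℝ (⊤ : ℕ∞) φ s) (hp : p ∈ s) :
    Ds s v (Ds s w φ) p = Ds s w (Ds s v φ) p := by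
  have hd : DifferentiableWithinAt ℝ (fderivWithin ℝ φ s) s p :=
    ((hφ.fderivWithin hs (m := ((⊤ : ℕ∞) : WithTop ℕ∞)) (by simp)).differentiableOn (by simp)) p hp
  have key : ∀ v w, Ds s v (Ds s w φ) p = fderivWithin ℝ (fderivWithin ℝ φ s) s p v w := by
    intro v w
    refine HasD.eq ?_ hs hp
    exact ⟨_, hd.hasFDerivWithinAt.clm_apply (hasFDerivWithinAt_const w p s), by simp⟩
  rw [key, key]
  refine (hφ p hp).isSymmSndFDerivWithinAt (n := ((⊤ : ℕ∞) : WithTop ℕ∞)) ?_ hs (hc hp) hp v w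
  simp only [minSmoothness_of_isRCLikeNormedField]
  exact WithTop.coe_le_coe.2 (le_top : (2 : ℕ∞) ≤ ⊤)

end HasDRules

theorem pd_contDiff {n : ℕ} {f : (Fin n → ℝ) → ℝ} (hf : ContDiff ℝ (⊤ : ℕ∞) f) (j : Fin n) :
    ContDiff ℝ (⊤ : ℕ∞) (pd f j) :=
  (hf.fderiv_right (m := ((⊤ : ℕ∞) : WithTop ℕ∞)) (by simp)).clm_apply contDiff_const

theorem pd_comm {n : ℕ} {f : (Fin n → ℝ) → ℝ} (hf : ContDiff ℝ (⊤ : ℕ∞) f) (j k : Fin n)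
    (q : Fin n → ℝ) : pd (pd f j) k q = pd (pd f k) j q := by
  have h := Ds_comm (s := (univ : Set (Fin n → ℝ))) (v := Pi.single k 1) (w := Pi.single j 1) (p := q)
    uniqueDiffOn_univ (by simp) hf.contDiffOn (mem_univ q)
  have e : ∀ (F : (Fin n → ℝ) → ℝ) i, Ds univ (Pi.single i 1) F = pd F i := by
    intro F i; funext x; simp [Ds, pd, fderivWithin_univ]
  simpa only [e] using h

section Strip

variable {E : Type*} [NormedAddCommGroup E] [NormedSpace ℝ E] {t : ℝ} {U : Set E}
  {φ : ℝ × E → ℝ} {τ : ℝ} {q : E}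

theorem strip_unique (ht : 0 < t) (hU : IsOpen U) : UniqueDiffOn ℝ (Icc 0 t ×ˢ U) :=
  (uniqueDiffOn_Icc ht).prod hU.uniqueDiffOn

set_option linter.unusedSectionVars false in
theorem strip_closure (ht : 0 < t) (hU : IsOpen U) :
    (Icc 0 t ×ˢ U) ⊆ closure (interior (Icc 0 t ×ˢ U)) := by
  rw [interior_prod_eq, closure_prod_eq, interior_Icc, closure_Ioo ht.ne, hU.interior_eq]
  exact prod_mono le_rfl subset_closure

theorem strip_slice (hU : IsOpen U) (hφ : ContDiffOn ℝ (⊤ : ℕ∞) φ (Icc 0 t ×ˢ U))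
    (hτ : τ ∈ Icc 0 t) (hq : q ∈ U) :
    HasFDerivAt (fun x => φ (τ, x))
      ((fderivWithin ℝ φ (Icc 0 t ×ˢ U) (τ, q)).comp (ContinuousLinearMap.inr ℝ ℝ E)) q := by
  have h1 := ((hφ.differentiableOn (by simp)) (τ, q) ⟨hτ, hq⟩).hasFDerivWithinAt
  have h2 : HasFDerivWithinAt (fun x : E => (τ, x)) (ContinuousLinearMap.inr ℝ ℝ E) U q :=
    (hasFDerivAt_prodMk_right τ q).hasFDerivWithinAt
  exact (h1.comp q h2 (fun x hx => ⟨hτ, hx⟩)).hasFDerivAt (hU.mem_nhds hq)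

theorem strip_time (hU : IsOpen U) (hφ : ContDiffOn ℝ (⊤ : ℕ∞) φ (Icc 0 t ×ˢ U))
    (hτ : τ ∈ Ioo 0 t) (hq : q ∈ U) :
    HasDerivAt (fun σ => φ (σ, q)) (Ds (Icc 0 t ×ˢ U) (1, 0) φ (τ, q)) τ := by
  have h1 := ((hφ.differentiableOn (by simp)) (τ, q) ⟨Ioo_subset_Icc_self hτ, hq⟩).hasFDerivWithinAt
  have h2 := h1.hasFDerivAt (prod_mem_nhds (Icc_mem_nhds hτ.1 hτ.2) (hU.mem_nhds hq))
  have h3 : HasDerivAt (fun σ : ℝ => (σ, q)) ((1 : ℝ), (0 : E)) τ :=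
    (hasDerivAt_id τ).prodMk (hasDerivAt_const τ q)
  exact h2.comp_hasDerivAt τ h3

theorem strip_integral [ProperSpace E] (ht : 0 < t) (hU : IsOpen U)
    (hφ : ContDiffOn ℝ (⊤ : ℕ∞) φ (Icc 0 t ×ˢ U)) (hq : q ∈ U) :
    ∃ S' : E →L[ℝ] ℝ, HasFDerivAt (fun x => ∫ τ in (0:ℝ)..t, φ (τ, x)) S' q ∧
      ∀ w, S' w = ∫ τ in (0:ℝ)..t, Ds (Icc 0 t ×ˢ U) (0, w) φ (τ, q) := by
  set s := Icc 0 t ×ˢ U with hs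
  obtain ⟨r, hr, hrU⟩ := Metric.nhds_basis_closedBall.mem_iff.1 (hU.mem_nhds hq)
  have hcF : ContinuousOn (fderivWithin ℝ φ s) s :=
    hφ.continuousOn_fderivWithin (strip_unique ht hU) (by simp)
  have huI : uIcc 0 t = Icc 0 t := uIcc_of_le ht.le
  let F' : E → ℝ → (E →L[ℝ] ℝ) := fun x τ =>
    (fderivWithin ℝ φ s (τ, x)).comp (ContinuousLinearMap.inr ℝ ℝ E)
  have hsl : ∀ x ∈ U, ContinuousOn (fun τ : ℝ => (τ, x)) (Icc 0 t) := fun x _ => by fun_prop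
  have hcφ : ∀ x ∈ U, IntervalIntegrable (fun τ => φ (τ, x)) volume 0 t := fun x hx => by
    refine ContinuousOn.intervalIntegrable ?_
    rw [huI]
    exact hφ.continuousOn.comp (hsl x hx) (fun τ hτ => ⟨hτ, hx⟩)
  have hcF' : IntervalIntegrable (F' q) volume 0 t := by
    refine ContinuousOn.intervalIntegrable ?_
    rw [huI]
    exact (hcF.comp (hsl q hq) (fun τ hτ => ⟨hτ, hq⟩)).clm_comp continuousOn_const
  have hK : IsCompact (Icc 0 t ×ˢ Metric.closedBall q r) := isCompact_Icc.prod (isCompact_closedBall q r)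
  have hcK : ContinuousOn (fun p : ℝ × E => F' p.2 p.1) (Icc 0 t ×ˢ Metric.closedBall q r) :=
    (hcF.mono (prod_mono le_rfl hrU)).clm_comp continuousOn_const
  obtain ⟨M, hM⟩ := hK.exists_bound_of_continuousOn hcK
  have hsub : ∀ τ, τ ∈ uIoc 0 t → τ ∈ Icc 0 t := fun τ hτ => by
    rw [uIoc_of_le ht.le] at hτ; exact Ioc_subset_Icc_self hτ
  have main := intervalIntegral.hasFDerivAt_integral_of_dominated_of_fderiv_le
    (μ := volume) (a := 0) (b := t) (F := fun x τ => φ (τ, x)) (F' := F') (x₀ := q)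
    (s := Metric.closedBall q r) (bound := fun _ => M) (Metric.closedBall_mem_nhds q hr)
    (Filter.eventually_of_mem (hU.mem_nhds hq) fun x hx => (hcφ x hx).def'.aestronglyMeasurable)
    (hcφ q hq) hcF'.def'.aestronglyMeasurable
    (Filter.Eventually.of_forall fun τ hτ x hx => hM (τ, x) ⟨hsub τ hτ, hx⟩)
    intervalIntegrable_const
    (Filter.Eventually.of_forall fun τ hτ x hx => strip_slice hU hφ (hsub τ hτ) (hrU hx))
  refine ⟨_, main, fun w => ?_⟩
  rw [ContinuousLinearMap.intervalIntegral_apply hcF']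
  rfl

end Strip

theorem lagr_algebra {n : ℕ} (u du cd b ξ ζ η ξ' ζ' η' : Fin n → ℝ) (bd cdd : Fin n → Fin n → ℝ)
    (bdd : Fin n → Fin n → Fin n → ℝ)
    (hdu : ∀ i, du i + (∑ j, (bd i j - bd j i) * u j) + cd i = 0)
    (hbdd : ∀ i j k, bdd i j k = bdd i k j) (hcdd : ∀ j k, cdd j k = cdd k j) :
    ∑ i, ((ξ' i * ζ' i + u i * η' i)
      + (((∑ j, ((∑ k, bdd i j k * ξ k) * ζ j + bd i j * η j)) * u i
          + (∑ j, bd i j * ζ j) * ξ' i)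
        + ((∑ j, bd i j * ξ j) * ζ' i + b i * η' i)))
      - ∑ j, ((∑ k, cdd j k * ξ k) * ζ j + cd j * η j)
    = ((∑ i, ξ' i * ζ' i)
      + (∑ i, ∑ j, bd i j * (ξ' i * ζ j + ζ' i * ξ j))
      + ∑ j, ∑ k, ((∑ i, bdd i j k * u i) - cdd j k) * (ξ j * ζ k))
      + ∑ i, ((du i + ∑ j, bd i j * u j) * η i + (u i + b i) * η' i) := by
  have hdu' : ∀ i, du i + ∑ j, bd i j * u j = (∑ j, bd j i * u j) - cd i := fun i => by
    have := hdu i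
    simp only [sub_mul, Finset.sum_sub_distrib] at this
    linarith
  simp only [hdu']
  have e1 : ∑ j, ∑ k, ((∑ i, bdd i j k * u i) - cdd j k) * (ξ j * ζ k)
      = (∑ i, (∑ j, (∑ k, bdd i j k * ξ k) * ζ j) * u i) - ∑ j, (∑ k, cdd j k * ξ k) * ζ j := by
    simp only [sub_mul, Finset.sum_sub_distrib, Finset.sum_mul]
    congr 1
    · rw [Finset.sum_comm]
      rw [Finset.sum_congr rfl fun k _ => Finset.sum_comm, Finset.sum_comm]
      refine Finset.sum_congr rfl fun i _ => Finset.sum_congr rfl fun j _ =>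
        Finset.sum_congr rfl fun k _ => ?_
      rw [hbdd i j k]; ring
    · rw [Finset.sum_comm]
      refine Finset.sum_congr rfl fun j _ => Finset.sum_congr rfl fun k _ => ?_
      rw [hcdd j k]; ring
  have e2 : ∑ i, (∑ j, bd j i * u j) * η i = ∑ i, (∑ j, bd i j * η j) * u i := by
    simp only [Finset.sum_mul]
    rw [Finset.sum_comm]
    exact Finset.sum_congr rfl fun j _ => Finset.sum_congr rfl fun k _ => by ring
  have e3 : ∑ i, ∑ j, bd i j * (ξ' i * ζ j + ζ' i * ξ j)
      = (∑ i, (∑ j, bd i j * ζ j) * ξ' i) + ∑ i, (∑ j, bd i j * ξ j) * ζ' i := by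
    rw [← Finset.sum_add_distrib]
    refine Finset.sum_congr rfl fun i _ => ?_
    simp only [Finset.sum_mul]
    rw [← Finset.sum_add_distrib]
    exact Finset.sum_congr rfl fun k _ => by ring
  rw [e1, e3]
  simp only [sub_mul, add_mul, Finset.sum_add_distrib, Finset.sum_sub_distrib, e2]
  ring

theorem HasD.const {V : Type*} [NormedAddCommGroup V] [NormedSpace ℝ V] {s : Set V} {v p : V}
    (c : ℝ) : HasD s v p (fun _ => c) 0 :=
  ⟨0, hasFDerivWithinAt_const c p s, rfl⟩

/-- The second variation of the Lagrangian along a family, pointwise. -/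
theorem lagr_point {V : Type*} [NormedAddCommGroup V] [NormedSpace ℝ V] {s : Set V}
    (hs : UniqueDiffOn ℝ s) (hc : s ⊆ closure (interior s)) {n : ℕ}
    (B : Fin n → (Fin n → ℝ) → ℝ) (C : (Fin n → ℝ) → ℝ)
    (hB : ∀ i, ContDiff ℝ (⊤ : ℕ∞) (B i)) (hC : ContDiff ℝ (⊤ : ℕ∞) C)
    (g : Fin n → V → ℝ) (hg : ∀ i, ContDiffOn ℝ (⊤ : ℕ∞) (g i) s) (e v w p : V) (hp : p ∈ s)
    (heom : ∀ i, Ds s e (Ds s e (g i)) p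
      + (∑ j, (pd (B i) j (fun l => g l p) - pd (B j) i (fun l => g l p)) * Ds s e (g j) p)
      + pd C i (fun l => g l p) = 0) :
    Ds s v (Ds s w (fun x => (1:ℝ)/2 * ∑ i, Ds s e (g i) x ^ 2
        + ∑ i, B i (fun l => g l x) * Ds s e (g i) x - C (fun l => g l x))) p
    = ((∑ i, Ds s e (Ds s v (g i)) p * Ds s e (Ds s w (g i)) p)
      + (∑ i, ∑ j, pd (B i) j (fun l => g l p) * (Ds s e (Ds s v (g i)) p * Ds s w (g j) p
          + Ds s e (Ds s w (g i)) p * Ds s v (g j) p))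
      + ∑ j, ∑ k, ((∑ i, pd (pd (B i) j) k (fun l => g l p) * Ds s e (g i) p)
          - pd (pd C j) k (fun l => g l p)) * (Ds s v (g j) p * Ds s w (g k) p))
      + Ds s e (fun x => ∑ i, (Ds s e (g i) x + B i (fun l => g l x))
          * Ds s v (Ds s w (g i)) x) p := by
  have hu : ∀ i (z : V), ContDiffOn ℝ (⊤ : ℕ∞) (Ds s z (g i)) s := fun i z => Ds_contDiffOn hs (hg i) z
  have hD : ∀ i (z x : V), x ∈ s → HasD s z x (g i) (Ds s z (g i) x) :=
    fun i z x hx => HasD.of_smooth (hg i) hx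
  have hDu : ∀ i (z x : V), x ∈ s → HasD s z x (Ds s e (g i)) (Ds s e (Ds s z (g i)) x) :=
    fun i z x hx => by
      rw [Ds_comm hs hc (hg i) hx]; exact HasD.of_smooth (hu i e) hx
  have h1 : EqOn (Ds s w (fun x => (1:ℝ)/2 * ∑ i, Ds s e (g i) x ^ 2
        + ∑ i, B i (fun l => g l x) * Ds s e (g i) x - C (fun l => g l x)))
      (fun x => ∑ i, (Ds s e (g i) x * Ds s e (Ds s w (g i)) x
        + ((∑ j, pd (B i) j (fun l => g l x) * Ds s w (g j) x) * Ds s e (g i) x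
          + B i (fun l => g l x) * Ds s e (Ds s w (g i)) x))
        - ∑ j, pd C j (fun l => g l x) * Ds s w (g j) x) s := by
    intro x hx
    have h := (((HasD.const (s := s) (v := w) (p := x) ((1:ℝ)/2)).mul
      (HasD.sum fun i => (hDu i w x hx).mul (hDu i w x hx))).add
      (HasD.sum fun i => (HasD.comp (hB i) fun l => hD l w x hx).mul (hDu i w x hx))).sub
      (HasD.comp hC fun l => hD l w x hx)
    simp only [pow_two]
    rw [h.eq hs hx]
    simp only [Finset.sum_add_distrib]
    rw [Finset.sum_congr rfl fun i _ => mul_comm (Ds s e (Ds s w (g i)) x) (Ds s e (g i) x)]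
    ring
  rw [Ds_congr h1 hp]
  have hZ : ∀ i, HasD s v p (Ds s e (Ds s w (g i))) (Ds s e (Ds s v (Ds s w (g i))) p) := fun i => by
    rw [Ds_comm hs hc (hu i w) hp]; exact HasD.of_smooth (Ds_contDiffOn hs (hu i w) e) hp
  have hW : ∀ i, HasD s v p (Ds s w (g i)) (Ds s v (Ds s w (g i)) p) := fun i =>
    HasD.of_smooth (hu i w) hp
  have h2 := (HasD.sum fun i => ((hDu i v p hp).mul (hZ i)).add
      (((HasD.sum fun j => (HasD.comp (pd_contDiff (hB i) j) fun l => hD l v p hp).mul (hW j)).mul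
        (hDu i v p hp)).add ((HasD.comp (hB i) fun l => hD l v p hp).mul (hZ i)))).sub
    (HasD.sum fun j => (HasD.comp (pd_contDiff hC j) fun l => hD l v p hp).mul (hW j))
  rw [h2.eq hs hp]
  have h3 := HasD.sum fun i => ((HasD.of_smooth (v := e) (hu i e) hp).add
      (HasD.comp (hB i) fun l => hD l e p hp)).mul
      (HasD.of_smooth (v := e) (Ds_contDiffOn hs (hu i w) v) hp)
  rw [h3.eq hs hp]
  exact lagr_algebra (fun i => Ds s e (g i) p) (fun i => Ds s e (Ds s e (g i)) p)
    (fun i => pd C i (fun l => g l p)) (fun i => B i (fun l => g l p))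
    (fun i => Ds s v (g i) p) (fun i => Ds s w (g i) p) (fun i => Ds s v (Ds s w (g i)) p)
    (fun i => Ds s e (Ds s v (g i)) p) (fun i => Ds s e (Ds s w (g i)) p)
    (fun i => Ds s e (Ds s v (Ds s w (g i))) p) (fun i j => pd (B i) j (fun l => g l p))
    (fun j k => pd (pd C j) k (fun l => g l p)) (fun i j k => pd (pd (B i) j) k (fun l => g l p))
    heom (fun i j k => pd_comm (hB i) j k _) (fun j k => pd_comm hC j k _)

section Strip2

variable {E : Type*} [NormedAddCommGroup E] [NormedSpace ℝ E] {t : ℝ} {U : Set E} {τ : ℝ} {q : E}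

theorem strip_time_pi {n : ℕ} {φ : Fin n → ℝ × E → ℝ} (hU : IsOpen U)
    (hφ : ∀ i, ContDiffOn ℝ (⊤ : ℕ∞) (φ i) (Icc 0 t ×ˢ U)) (hq : q ∈ U)
    {ψ : ℝ → Fin n → ℝ} (hψ : ∀ σ ∈ Ioo 0 t, ∀ i, ψ σ i = φ i (σ, q)) (hτ : τ ∈ Ioo 0 t)
    (i : Fin n) : deriv ψ τ i = Ds (Icc 0 t ×ˢ U) (1, 0) (φ i) (τ, q) := by
  have h1 : ψ =ᶠ[nhds τ] fun σ i => φ i (σ, q) :=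
    Filter.eventually_of_mem (Ioo_mem_nhds hτ.1 hτ.2) fun σ hσ => funext fun i => hψ σ hσ i
  have h2 : HasDerivAt (fun σ i => φ i (σ, q))
      (fun i => Ds (Icc 0 t ×ˢ U) (1, 0) (φ i) (τ, q)) τ :=
    hasDerivAt_pi.2 fun i => strip_time hU (hφ i) hτ hq
  rw [h1.deriv_eq, h2.deriv]

theorem strip_boundary {φ : ℝ × E → ℝ} (ht : 0 < t) (hU : IsOpen U)
    (hφ : ContDiffOn ℝ (⊤ : ℕ∞) φ (Icc 0 t ×ˢ U)) (hq : q ∈ U) (hτ : τ ∈ Icc 0 t)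
    (l : E →L[ℝ] ℝ) (hl : ∀ x ∈ U, φ (τ, x) = l x) (a b : E) :
    Ds (Icc 0 t ×ˢ U) (0, a) (Ds (Icc 0 t ×ˢ U) (0, b) φ) (τ, q) = 0 := by
  have h1 : ∀ x ∈ U, Ds (Icc 0 t ×ˢ U) (0, b) φ (τ, x) = l b := fun x hx => by
    have h2 := strip_slice hU hφ hτ hx
    have h3 : HasFDerivAt (fun x => φ (τ, x)) l x :=
      l.hasFDerivAt.congr_of_eventuallyEq (Filter.eventually_of_mem (hU.mem_nhds hx) hl)
    have h4 := DFunLike.congr_fun (h2.unique h3) b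
    simpa [Ds] using h4
  have h2 := strip_slice hU (Ds_contDiffOn (strip_unique ht hU) hφ (0, b)) hτ hq
  have h3 : HasFDerivAt (fun x => Ds (Icc 0 t ×ˢ U) (0, b) φ (τ, x)) (0 : E →L[ℝ] ℝ) q :=
    (hasFDerivAt_const (l b) q).congr_of_eventuallyEq
      (Filter.eventually_of_mem (hU.mem_nhds hq) h1)
  have h4 := DFunLike.congr_fun (h2.unique h3) a
  simpa [Ds] using h4

theorem strip_ftc {H : ℝ × E → ℝ} (ht : 0 < t) (hU : IsOpen U)
    (hH : ContDiffOn ℝ (⊤ : ℕ∞) H (Icc 0 t ×ˢ U)) (hq : q ∈ U) :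
    IntervalIntegrable (fun τ => Ds (Icc 0 t ×ˢ U) (1, 0) H (τ, q)) volume 0 t ∧
    ∫ τ in (0:ℝ)..t, Ds (Icc 0 t ×ˢ U) (1, 0) H (τ, q) = H (t, q) - H (0, q) := by
  have hsl : ContinuousOn (fun τ : ℝ => (τ, q)) (Icc 0 t) := by fun_prop
  have hi : IntervalIntegrable (fun τ => Ds (Icc 0 t ×ˢ U) (1, 0) H (τ, q)) volume 0 t := by
    refine ContinuousOn.intervalIntegrable ?_
    rw [uIcc_of_le ht.le]
    exact (Ds_contDiffOn (strip_unique ht hU) hH (1, 0)).continuousOn.comp hsl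
      (fun τ hτ => ⟨hτ, hq⟩)
  refine ⟨hi, ?_⟩
  refine intervalIntegral.integral_eq_sub_of_hasDerivAt_of_le (f := fun τ => H (τ, q)) ht.le
    (hH.continuousOn.comp hsl (fun τ hτ => ⟨hτ, hq⟩)) (fun τ hτ => strip_time hU hH hτ hq) hi

end Strip2

/-- The direction of the boundary value `q_a^j`. -/
def wdir {n : ℕ} (a : Fin 2) (j : Fin n) : (Fin n → ℝ) × (Fin n → ℝ) :=
  if a = 0 then (Pi.single j 1, 0) else (0, Pi.single j 1)

theorem pdS_eq {n : ℕ} {S : ℝ → (Fin n → ℝ) → (Fin n → ℝ) → ℝ} {t : ℝ}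
    {q : (Fin n → ℝ) × (Fin n → ℝ)} {S' : (Fin n → ℝ) × (Fin n → ℝ) →L[ℝ] ℝ}
    (h : HasFDerivAt (fun x : (Fin n → ℝ) × (Fin n → ℝ) => S t x.1 x.2) S' q)
    (a : Fin 2) (j : Fin n) : pdS S a j t q.1 q.2 = S' (wdir a j) := by
  obtain ⟨q0, q1⟩ := q
  unfold pdS wdir
  split_ifs with ha
  · have h2 := HasFDerivAt.comp (f := fun x : Fin n → ℝ => (x, q1)) q0 h
      (hasFDerivAt_prodMk_left q0 q1)
    have h3 := h2.fderiv
    simp only [Function.comp_def] at h3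
    rw [h3]; rfl
  · have h2 := HasFDerivAt.comp (f := fun x : Fin n → ℝ => (q0, x)) q1 h
      (hasFDerivAt_prodMk_right q0 q1)
    have h3 := h2.fderiv
    simp only [Function.comp_def] at h3
    rw [h3]; rfl

/-- second boundary-value derivatives of `-S_γ` are computed by the
Hessian of the action evaluated on the corresponding Jacobi fields. -/
theorem statement12 {n : ℕ} (hn : 1 ≤ n)
    (B : Fin n → (Fin n → ℝ) → ℝ) (C : (Fin n → ℝ) → ℝ)
    (hB : ∀ i, ContDiff ℝ (⊤ : ℕ∞) (B i)) (hC : ContDiff ℝ (⊤ : ℕ∞) C)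
    (O : Set (ℝ × (Fin n → ℝ) × (Fin n → ℝ))) (F : SmoothFamily B C O)
    (t : ℝ) (q0 q1 : Fin n → ℝ) (hmem : (t, q0, q1) ∈ O) :
    ∀ (a b : Fin 2) (j k : Fin n),
      pdS (fun t' q0' q1' => pdS (fun t'' q0'' q1'' => -(famS F t'' q0'' q1'')) b k t' q0' q1')
          a j t q0 q1
        = -(hess B C t (fun σ => F.f σ t q0 q1)
            (jfield F t q0 q1 a j) (jfield F t q0 q1 b k)) := by
  intro a b j k
  have ht : 0 < t := F.pos _ hmem
  set U : Set ((Fin n → ℝ) × (Fin n → ℝ)) := {q | (t, q) ∈ O} with hUdef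
  have hU : IsOpen U := F.isOpen.preimage (by fun_prop : Continuous fun q => (t, q))
  have hq : (q0, q1) ∈ U := hmem
  set s : Set (ℝ × (Fin n → ℝ) × (Fin n → ℝ)) := Icc 0 t ×ˢ U with hsdef
  have hs : UniqueDiffOn ℝ s := strip_unique ht hU
  have hc : s ⊆ closure (interior s) := strip_closure ht hU
  let g : Fin n → ℝ × (Fin n → ℝ) × (Fin n → ℝ) → ℝ := fun i p => F.f p.1 t p.2.1 p.2.2 i
  have hg : ∀ i, ContDiffOn ℝ (⊤ : ℕ∞) (g i) s := by
    intro i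
    have h1 : ContDiff ℝ (⊤ : ℕ∞)
        (fun p : ℝ × (Fin n → ℝ) × (Fin n → ℝ) => (p.1, t, p.2.1, p.2.2)) := by fun_prop
    have h2 := F.smooth.comp (s := s) h1.contDiffOn (fun p hp => ⟨hp.2, hp.1⟩)
    exact contDiffOn_pi.1 h2 i
  have hu : ∀ i z, ContDiffOn ℝ (⊤ : ℕ∞) (Ds s z (g i)) s := fun i z => Ds_contDiffOn hs (hg i) z
  have hG : ContDiffOn ℝ (⊤ : ℕ∞) (fun x => fun l => g l x) s := contDiffOn_pi.2 hg
  have hBG : ∀ i, ContDiffOn ℝ (⊤ : ℕ∞) (fun x => B i (fun l => g l x)) s :=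
    fun i => (hB i).comp_contDiffOn hG
  set e : ℝ × (Fin n → ℝ) × (Fin n → ℝ) := (1, 0) with he
  set L : ℝ × (Fin n → ℝ) × (Fin n → ℝ) → ℝ := fun x => (1:ℝ)/2 * ∑ i, Ds s e (g i) x ^ 2
        + ∑ i, B i (fun l => g l x) * Ds s e (g i) x - C (fun l => g l x) with hL
  have hLs : ContDiffOn ℝ (⊤ : ℕ∞) L s :=
    ((contDiffOn_const.mul (ContDiffOn.sum fun i _ => (hu i e).pow 2)).add
      (ContDiffOn.sum fun i _ => (hBG i).mul (hu i e))).sub (hC.comp_contDiffOn hG)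
  -- velocities
  have hvel : ∀ q ∈ U, ∀ τ ∈ Ioo 0 t, ∀ i,
      deriv (fun τ => F.f τ t q.1 q.2) τ i = Ds s e (g i) (τ, q) := fun q hq τ hτ i =>
    strip_time_pi hU hg hq (fun σ _ i => rfl) hτ i
  have hS : ∀ q ∈ U, famS F t q.1 q.2 = ∫ τ in (0:ℝ)..t, L (τ, q) := by
    intro q hq
    refine intervalIntegral.integral_congr_Ioo_of_le ht.le fun τ hτ => ?_
    simp only [hvel q hq τ hτ, hL]
    rfl
  have hfirst : ∀ q ∈ U, pdS (fun t'' q0'' q1'' => -(famS F t'' q0'' q1'')) b k t q.1 q.2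
      = -∫ τ in (0:ℝ)..t, Ds s (0, wdir b k) L (τ, q) := by
    intro q hq
    obtain ⟨S', h1, h2⟩ := strip_integral ht hU hLs hq
    have h3 : HasFDerivAt (fun x : (Fin n → ℝ) × (Fin n → ℝ) => -(famS F t x.1 x.2)) (-S') q :=
      h1.neg.congr_of_eventuallyEq (Filter.eventually_of_mem (hU.mem_nhds hq) fun x hx => by
        simp [hS x hx])
    rw [pdS_eq (S := fun t'' q0'' q1'' => -(famS F t'' q0'' q1'')) h3, neg_apply, h2]
  have hsecond : pdS (fun t' q0' q1' =>
        pdS (fun t'' q0'' q1'' => -(famS F t'' q0'' q1'')) b k t' q0' q1') a j t q0 q1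
      = -∫ τ in (0:ℝ)..t, Ds s (0, wdir a j) (Ds s (0, wdir b k) L) (τ, (q0, q1)) := by
    obtain ⟨S', h1, h2⟩ := strip_integral ht hU (Ds_contDiffOn hs hLs (0, wdir b k)) hq
    have h3 : HasFDerivAt (fun x : (Fin n → ℝ) × (Fin n → ℝ) =>
        pdS (fun t'' q0'' q1'' => -(famS F t'' q0'' q1'')) b k t x.1 x.2) (-S') (q0, q1) :=
      h1.neg.congr_of_eventuallyEq (Filter.eventually_of_mem (hU.mem_nhds hq) fun x hx => by
        simp [hfirst x hx, hsdef])
    have h4 := pdS_eq (S := fun t' q0' q1' =>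
      pdS (fun t'' q0'' q1'' => -(famS F t'' q0'' q1'')) b k t' q0' q1') h3 a j
    rw [neg_apply, h2] at h4
    exact h4
  rw [hsecond]
  congr 1
  -- Jacobi fields
  have hjf : ∀ (a : Fin 2) (j : Fin n), ∀ τ ∈ Ioo 0 t, ∀ i,
      jfield F t q0 q1 a j τ i = Ds s (0, wdir a j) (g i) (τ, (q0, q1)) := by
    intro a j τ hτ i
    exact pdS_eq (S := fun _ q0 q1 => F.f τ t q0 q1 i) (t := t)
      (strip_slice hU (hg i) (Ioo_subset_Icc_self hτ) hq) a j
  have hjf' : ∀ (a : Fin 2) (j : Fin n), ∀ τ ∈ Ioo 0 t, ∀ i,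
      deriv (jfield F t q0 q1 a j) τ i = Ds s e (Ds s (0, wdir a j) (g i)) (τ, (q0, q1)) :=
    fun a j τ hτ i => strip_time_pi hU (fun i => hu i (0, wdir a j)) hq (hjf a j) hτ i
  have hacc : ∀ τ ∈ Ioo 0 t, ∀ i, deriv (deriv fun τ => F.f τ t q0 q1) τ i
      = Ds s e (Ds s e (g i)) (τ, (q0, q1)) := fun τ hτ i =>
    strip_time_pi hU (fun i => hu i e) hq (hvel (q0, q1) hq) hτ i
  have heom : ∀ τ ∈ Ioo 0 t, ∀ i, Ds s e (Ds s e (g i)) (τ, (q0, q1))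
      + (∑ j, (pd (B i) j (fun l => g l (τ, (q0, q1))) - pd (B j) i (fun l => g l (τ, (q0, q1))))
        * Ds s e (g j) (τ, (q0, q1)))
      + pd C i (fun l => g l (τ, (q0, q1))) = 0 := by
    intro τ hτ i
    have h := F.isClassical _ hmem τ (Ioo_subset_Icc_self hτ) i
    simp only [hacc τ hτ, hvel (q0, q1) hq τ hτ] at h
    exact h
  set H : ℝ × (Fin n → ℝ) × (Fin n → ℝ) → ℝ := fun x =>
    ∑ i, (Ds s e (g i) x + B i (fun l => g l x))
      * Ds s (0, wdir a j) (Ds s (0, wdir b k) (g i)) x with hH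
  have hHs : ContDiffOn ℝ (⊤ : ℕ∞) H s := ContDiffOn.sum fun i _ =>
    ((hu i e).add (hBG i)).mul (Ds_contDiffOn hs (hu i _) _)
  obtain ⟨hint, hftc⟩ := strip_ftc ht hU hHs hq
  have hb0 : H (0, (q0, q1)) = 0 := Finset.sum_eq_zero fun i _ => by
    rw [strip_boundary ht hU (hg i) hq (left_mem_Icc.2 ht.le)
      ((ContinuousLinearMap.proj i).comp (ContinuousLinearMap.fst ℝ (Fin n → ℝ) (Fin n → ℝ)))
      (fun x hx => congrFun (F.bdry0 (t, x) hx) i), mul_zero]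
  have hb1 : H (t, (q0, q1)) = 0 := Finset.sum_eq_zero fun i _ => by
    rw [strip_boundary ht hU (hg i) hq (right_mem_Icc.2 ht.le)
      ((ContinuousLinearMap.proj i).comp (ContinuousLinearMap.snd ℝ (Fin n → ℝ) (Fin n → ℝ)))
      (fun x hx => congrFun (F.bdry1 (t, x) hx) i), mul_zero]
  rw [hb0, hb1, sub_zero] at hftc
  have hLi : IntervalIntegrable
      (fun τ => Ds s (0, wdir a j) (Ds s (0, wdir b k) L) (τ, (q0, q1))) volume 0 t := by
    refine ContinuousOn.intervalIntegrable ?_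
    rw [uIcc_of_le ht.le]
    exact (Ds_contDiffOn hs (Ds_contDiffOn hs hLs _) _).continuousOn.comp
      (by fun_prop : ContinuousOn (fun τ : ℝ => (τ, (q0, q1))) (Icc 0 t))
      (fun τ hτ => ⟨hτ, hq⟩)
  have hsplit := intervalIntegral.integral_sub hLi hint
  rw [hftc, sub_zero] at hsplit
  rw [← hsplit]
  refine intervalIntegral.integral_congr_Ioo_of_le ht.le fun τ hτ => ?_
  have hpt := lagr_point hs hc B C hB hC g hg e (0, wdir a j) (0, wdir b k) (τ, (q0, q1))
    ⟨Ioo_subset_Icc_self hτ, hq⟩ (heom τ hτ)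
  simp only [hjf a j τ hτ, hjf b k τ hτ, hjf' a j τ hτ, hjf' b k τ hτ, hvel (q0, q1) hq τ hτ]
  rw [sub_eq_iff_eq_add]
  exact hpt
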